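/- With the notation for f_m and γ̄_μ below, let 1 ≤ k ≤ n, let μ : {1,…,k} → {1,…,n} be strictly increasing, let x_1, …, x_k ∈ ℂ \ {0} satisfy ϑ(x_i/x_j) ≠ 0 for all i ≠ j, and let z ∈ ℂ \ {0} satisfy ϑ(c_{μ(r)} · (z h^{2(k+1−2r)})⁻¹) ≠ 0 for every r ∈ {1,…,k}. Then for each l ∈ {1,…,k}, replacing x_l by q x_l multiplies γ̄_μ by a fixed factor: γ̄_μ(x_1, …, q x_l, …, x_k; z) = z · q^{−n} · h^{−n} · x_l^{−n} · (∏_{i=1}^{n} a_i) · γ̄_μ(x_1, …, x_k; z). -/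

import Mathlib

/-- The q-Pochhammer function `φ(x) = ∏_{n≥0} (1 - qⁿ x)` (formula (3.10) of the paper). -/
noncomputable def phi (q x : ℂ) : ℂ := ∏' n : ℕ, (1 - q ^ n * x)

/-- The theta function `ϑ(z) = φ(qz) φ(z⁻¹)` (formula (3.13) of the paper). -/
noncomputable def theta (q z : ℂ) : ℂ := phi q (q * z) * phi q z⁻¹

/-- The constant `c_m = (-1)ⁿ h^{2m-n}` of formula (A.6) of the paper
(here `h` is a square root of `ħ`, so `ħ = h²`). -/
noncomputable def cc (n : ℕ) (h : ℂ) (m : ℕ) : ℂ :=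
  (-1 : ℂ) ^ n * h ^ (2 * (m : ℤ) - (n : ℤ))

/-- The building block `f_m(x, w)` of the elliptic stable envelope for `T*Gr(k,n)`
(formula (A.6) of the paper):
`f_m(x,w) = (ϑ(c_m x w⁻¹ a_m⁻¹)/ϑ(c_m w⁻¹)) ∏_{i<m} ϑ(x/aᵢ) ∏_{i>m} ϑ(h²x/aᵢ)`. -/
noncomputable def fEnv (q h : ℂ) (n : ℕ) (a : ℕ → ℂ) (m : ℕ) (x w : ℂ) : ℂ :=
  (theta q (cc n h m * x * w⁻¹ * (a m)⁻¹) / theta q (cc n h m * w⁻¹)) *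
    (∏ i ∈ Finset.Ico 1 m, theta q (x / a i)) *
    (∏ i ∈ Finset.Ioc m n, theta q (h ^ 2 * x / a i))

/-- The elliptic stable envelope for `T*Gr(k,n)` (formulas (A.7)–(A.8) of the paper):
`γ̄_μ(x₁,…,x_k; z) = Σ_{τ ∈ S_k} (∏_{τ(i)<τ(j)} ϑ(h²xᵢ/xⱼ)/ϑ(xᵢ/xⱼ))
∏ᵢ f_{μ(τ(i))}(xᵢ, z h^{2(k+1-2τ(i))})`, where the variables are indexed `1,…,k`,
the permutation `σ : Equiv.Perm (Fin k)` gives `τ(i) = σ(i-1)+1` in 1-based indexing,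
and each unordered pair `{i,j}` contributes exactly one factor, oriented so that
`τ(i) < τ(j)`. -/
noncomputable def gammaBar (q h : ℂ) (n k : ℕ) (a : ℕ → ℂ) (μ : ℕ → ℕ)
    (x : ℕ → ℂ) (z : ℂ) : ℂ :=
  ∑ σ : Equiv.Perm (Fin k),
    (∏ p ∈ Finset.univ.filter (fun p : Fin k × Fin k => σ p.1 < σ p.2),
        theta q (h ^ 2 * x ((p.1 : ℕ) + 1) / x ((p.2 : ℕ) + 1)) /
          theta q (x ((p.1 : ℕ) + 1) / x ((p.2 : ℕ) + 1))) *
      ∏ i : Fin k, fEnv q h n a (μ ((σ i : ℕ) + 1)) (x ((i : ℕ) + 1))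
        (z * h ^ (2 * ((k : ℤ) + 1 - 2 * (((σ i : ℕ) : ℤ) + 1))))

theorem phi_eq_one_sub_mul {q : ℂ} (hq : ‖q‖ < 1) (x : ℂ) :
    phi q x = (1 - x) * phi q (q * x) := by
  have hmult : Multipliable fun n : ℕ => 1 - q ^ (n + 1) * x := by
    have hs : Summable fun n : ℕ => ‖-(q ^ (n + 1) * x)‖ := by
      have := (summable_geometric_of_lt_one (norm_nonneg q) hq).mul_left (‖q‖ * ‖x‖)
      refine this.congr fun n => ?_
      rw [norm_neg, norm_mul, norm_pow]
      ring
    simpa only [← sub_eq_add_neg] using multipliable_one_add_of_summable hs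
  have := tprod_eq_zero_mul' (f := fun n : ℕ => 1 - q ^ n * x) hmult
  simp only [phi]
  rw [this, pow_zero, one_mul]
  simp only [pow_succ, mul_assoc]

theorem theta_mul_left {q : ℂ} (hq0 : q ≠ 0) (hq : ‖q‖ < 1) {y : ℂ} (hy : y ≠ 0) :
    theta q (q * y) = -(q * y)⁻¹ * theta q y := by
  have h1 := phi_eq_one_sub_mul hq (q * y)
  have h2 := phi_eq_one_sub_mul hq (q * y)⁻¹
  have h3 : q * (q * y)⁻¹ = y⁻¹ := by field_simp
  rw [h3] at h2
  simp only [theta]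
  rw [h1, h2]
  field_simp
  ring

theorem theta_div {q : ℂ} (hq0 : q ≠ 0) (hq : ‖q‖ < 1) {y : ℂ} (hy : y ≠ 0) :
    theta q (y / q) = -y * theta q y := by
  have h1 := theta_mul_left hq0 hq (div_ne_zero hy hq0)
  rw [mul_div_cancel₀ _ hq0] at h1
  rw [h1]
  field_simp

theorem theta_ratio_mul_left {q : ℂ} (hq0 : q ≠ 0) (hq : ‖q‖ < 1) {h x y : ℂ}
    (hh : h ≠ 0) (hx : x ≠ 0) (hy : y ≠ 0) :
    theta q (h ^ 2 * (q * x) / y) / theta q (q * x / y) =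
      (h ^ 2)⁻¹ * (theta q (h ^ 2 * x / y) / theta q (x / y)) := by
  rw [show h ^ 2 * (q * x) / y = q * (h ^ 2 * x / y) by ring, mul_div_assoc q,
    theta_mul_left hq0 hq (by positivity), theta_mul_left hq0 hq (div_ne_zero hx hy),
    mul_div_mul_comm]
  congr 1
  field_simp

theorem theta_ratio_mul_right {q : ℂ} (hq0 : q ≠ 0) (hq : ‖q‖ < 1) {h x y : ℂ}
    (hh : h ≠ 0) (hx : x ≠ 0) (hy : y ≠ 0) :
    theta q (h ^ 2 * x / (q * y)) / theta q (x / (q * y)) =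
      h ^ 2 * (theta q (h ^ 2 * x / y) / theta q (x / y)) := by
  rw [show h ^ 2 * x / (q * y) = h ^ 2 * x / y / q by field_simp,
    show x / (q * y) = x / y / q by field_simp,
    theta_div hq0 hq (by positivity), theta_div hq0 hq (div_ne_zero hx hy),
    mul_div_mul_comm]
  congr 1
  field_simp

theorem prod_Icc_one_eq_Ico_mul_Ioc {M : Type*} [CommMonoid M] {m n : ℕ}
    (hm : m ∈ Finset.Icc 1 n) (f : ℕ → M) :
    ∏ i ∈ Finset.Icc 1 n, f i =
      f m * (∏ i ∈ Finset.Ico 1 m, f i) * ∏ i ∈ Finset.Ioc m n, f i := by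
  obtain ⟨h1, h2⟩ := Finset.mem_Icc.mp hm
  have e1 : Finset.Icc 1 n = Finset.Ico 1 (n + 1) := rfl
  have e2 : Finset.Ioc m n = Finset.Ico (m + 1) (n + 1) := by
    ext
    simp
  rw [e1, e2, ← Finset.prod_Ico_consecutive f h1 (by omega : m ≤ n + 1),
    Finset.prod_eq_prod_Ico_succ_bot (by omega : m < n + 1)]
  ac_rfl

theorem fEnv_mul_left {q : ℂ} (hq0 : q ≠ 0) (hq : ‖q‖ < 1) {h : ℂ} (hh : h ≠ 0)
    {n : ℕ} {a : ℕ → ℂ} (ha : ∀ i ∈ Finset.Icc 1 n, a i ≠ 0) {m : ℕ}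
    (hm : m ∈ Finset.Icc 1 n) {x w : ℂ} (hx : x ≠ 0) (hw : w ≠ 0) :
    fEnv q h n a m (q * x) w =
      w * q ^ (-(n : ℤ)) * h ^ (-(n : ℤ)) * x ^ (-(n : ℤ)) *
        (∏ i ∈ Finset.Icc 1 n, a i) * fEnv q h n a m x w := by
  obtain ⟨h1, h2⟩ := Finset.mem_Icc.mp hm
  have hc : cc n h m ≠ 0 :=
    mul_ne_zero (pow_ne_zero _ (neg_ne_zero.mpr one_ne_zero)) (zpow_ne_zero _ hh)
  have hI : ∏ i ∈ Finset.Ico 1 m, theta q (q * x / a i) =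
      (-(q * x)⁻¹) ^ (m - 1) * (∏ i ∈ Finset.Ico 1 m, a i) *
        ∏ i ∈ Finset.Ico 1 m, theta q (x / a i) := by
    rw [show (-(q * x)⁻¹) ^ (m - 1) = ∏ i ∈ Finset.Ico 1 m, (-(q * x)⁻¹) by simp,
      ← Finset.prod_mul_distrib, ← Finset.prod_mul_distrib]
    refine Finset.prod_congr rfl fun i hi => ?_
    have hai := ha i (by simp at hi ⊢; omega)
    rw [mul_div_assoc, theta_mul_left hq0 hq (div_ne_zero hx hai)]
    congr 1
    field_simp
  have hJ : ∏ i ∈ Finset.Ioc m n, theta q (h ^ 2 * (q * x) / a i) =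
      (-(q * x)⁻¹ * (h ^ 2)⁻¹) ^ (n - m) * (∏ i ∈ Finset.Ioc m n, a i) *
        ∏ i ∈ Finset.Ioc m n, theta q (h ^ 2 * x / a i) := by
    rw [show (-(q * x)⁻¹ * (h ^ 2)⁻¹) ^ (n - m) =
        ∏ i ∈ Finset.Ioc m n, (-(q * x)⁻¹ * (h ^ 2)⁻¹) by simp,
      ← Finset.prod_mul_distrib, ← Finset.prod_mul_distrib]
    refine Finset.prod_congr rfl fun i hi => ?_
    have hai := ha i (by simp at hi ⊢; omega)
    rw [show h ^ 2 * (q * x) / a i = q * (h ^ 2 * x / a i) by ring,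
      theta_mul_left hq0 hq (by positivity)]
    congr 1
    field_simp
  have ham := ha m hm
  have hK : theta q (cc n h m * (q * x) * w⁻¹ * (a m)⁻¹) =
      -(q * x)⁻¹ * w * a m * (cc n h m)⁻¹ * theta q (cc n h m * x * w⁻¹ * (a m)⁻¹) := by
    rw [show cc n h m * (q * x) * w⁻¹ * (a m)⁻¹ = q * (cc n h m * x * w⁻¹ * (a m)⁻¹) by ring,
      theta_mul_left hq0 hq (by positivity)]
    congr 1
    field_simp
  have hfactor : -(q * x)⁻¹ * (cc n h m)⁻¹ * (-(q * x)⁻¹) ^ (m - 1) *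
      (-(q * x)⁻¹ * (h ^ 2)⁻¹) ^ (n - m) =
      q ^ (-(n : ℤ)) * h ^ (-(n : ℤ)) * x ^ (-(n : ℤ)) := by
    obtain ⟨s, rfl⟩ := Nat.exists_eq_add_of_le' h1
    obtain ⟨t, rfl⟩ := Nat.exists_eq_add_of_le h2
    have hcc : cc (s + 1 + t) h (s + 1) = (-1) ^ (s + 1 + t) * (h ^ (s + 1) * (h ^ t)⁻¹) := by
      rw [cc, ← zpow_natCast h (s + 1), ← zpow_natCast h t, ← zpow_neg, ← zpow_add₀ hh]
      congr 2
      push_cast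
      ring
    have hsign : ((-1 : ℂ) ^ (s + 1 + t))⁻¹ = (-1) ^ (s + 1 + t) := by
      rw [← inv_pow]
      norm_num
    have hsq : ((-1 : ℂ) ^ (s + 1 + t)) * (-1) ^ (s + 1 + t) = 1 := by
      rw [← mul_pow]
      norm_num
    rw [hcc, mul_inv ((-1 : ℂ) ^ (s + 1 + t)), hsign, show s + 1 - 1 = s by omega,
      show s + 1 + t - (s + 1) = t by omega, neg_eq_neg_one_mul (q * x)⁻¹]
    simp only [zpow_neg, zpow_natCast]
    calc _ = (((-1 : ℂ) ^ (s + 1 + t)) * (-1) ^ (s + 1 + t)) *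
          ((q * x)⁻¹ ^ (s + 1 + t) * (h ^ (s + 1) * (h ^ t)⁻¹)⁻¹ * (h ^ 2)⁻¹ ^ t) := by
          ring
      _ = _ := by
          rw [hsq, inv_pow, mul_pow, inv_pow, ← pow_mul]
          field_simp
          ring
  simp only [fEnv]
  rw [hI, hJ, hK, prod_Icc_one_eq_Ico_mul_Ioc hm a]
  linear_combination (w * a m * (∏ i ∈ Finset.Ico 1 m, a i) * (∏ i ∈ Finset.Ioc m n, a i) *
    (theta q (cc n h m * x * w⁻¹ * (a m)⁻¹) / theta q (cc n h m * w⁻¹)) *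
    (∏ i ∈ Finset.Ico 1 m, theta q (x / a i)) *
    (∏ i ∈ Finset.Ioc m n, theta q (h ^ 2 * x / a i))) * hfactor

theorem prod_perm_lt_ite_fst {M : Type*} [CommMonoid M] {k : ℕ} (σ : Equiv.Perm (Fin k))
    (l : Fin k) (u : M) :
    ∏ p ∈ Finset.univ.filter (fun p : Fin k × Fin k => σ p.1 < σ p.2),
      (if p.1 = l then u else 1) = u ^ (k - 1 - (σ l : ℕ)) := by
  rw [Finset.prod_filter, Fintype.prod_prod_type, Finset.prod_eq_single l]
  · simp only [if_true]
    rw [Equiv.prod_comp σ (fun j => if σ l < j then u else 1), ← Finset.prod_filter,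
      Finset.prod_const, Finset.filter_lt_eq_Ioi, Fin.card_Ioi]
  · intro b _ hb
    simp [hb]
  · simp

theorem prod_perm_lt_ite_snd {M : Type*} [CommMonoid M] {k : ℕ} (σ : Equiv.Perm (Fin k))
    (l : Fin k) (u : M) :
    ∏ p ∈ Finset.univ.filter (fun p : Fin k × Fin k => σ p.1 < σ p.2),
      (if p.2 = l then u else 1) = u ^ (σ l : ℕ) := by
  rw [Finset.prod_filter, Fintype.prod_prod_type_right, Finset.prod_eq_single l]
  · simp only [if_true]
    rw [Equiv.prod_comp σ (fun j => if j < σ l then u else 1), ← Finset.prod_filter,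
      Finset.prod_const, Finset.filter_gt_eq_Iio, Fin.card_Iio]
  · intro b _ hb
    simp [hb]
  · simp

/-- **Quasi-periodicity of the elliptic stable envelope** (equation (A.10) of the
paper): replacing `x_l` by `q x_l` multiplies `γ̄_μ` by
`z q^{-n} h^{-n} x_l^{-n} ∏ᵢ aᵢ`; the factor is the same for every term of the
symmetrization. -/
theorem gammaBar_quasi_periodicity
    (q : ℂ) (hq0 : 0 < ‖q‖) (hq1 : ‖q‖ < 1)
    (h : ℂ) (hh : h ≠ 0)
    (n : ℕ) (hn : 1 ≤ n) (a : ℕ → ℂ)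
    (ha0 : ∀ i ∈ Finset.Icc 1 n, a i ≠ 0)
    (hdist : ∀ i ∈ Finset.Icc 1 n, ∀ j ∈ Finset.Icc 1 n, i ≠ j → a i ≠ a j)
    (k : ℕ) (hk1 : 1 ≤ k) (hkn : k ≤ n)
    (μ : ℕ → ℕ)
    (hμmem : ∀ r ∈ Finset.Icc 1 k, μ r ∈ Finset.Icc 1 n)
    (hμmono : ∀ r ∈ Finset.Icc 1 k, ∀ r' ∈ Finset.Icc 1 k, r < r' → μ r < μ r')
    (x : ℕ → ℂ) (hx0 : ∀ i ∈ Finset.Icc 1 k, x i ≠ 0)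
    (hxth : ∀ i ∈ Finset.Icc 1 k, ∀ j ∈ Finset.Icc 1 k, i ≠ j →
        theta q (x i / x j) ≠ 0)
    (z : ℂ) (hz : z ≠ 0)
    (hzth : ∀ r ∈ Finset.Icc 1 k,
        theta q (cc n h (μ r) * (z * h ^ (2 * ((k : ℤ) + 1 - 2 * (r : ℤ))))⁻¹) ≠ 0)
    (l : ℕ) (hl : l ∈ Finset.Icc 1 k) :
    gammaBar q h n k a μ (Function.update x l (q * x l)) z =
      z * q ^ (-(n : ℤ)) * h ^ (-(n : ℤ)) * (x l) ^ (-(n : ℤ)) *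
        (∏ i ∈ Finset.Icc 1 n, a i) * gammaBar q h n k a μ x z := by
  have hq : q ≠ 0 := norm_pos_iff.mp hq0
  obtain ⟨hl1, hlk⟩ := Finset.mem_Icc.mp hl
  obtain ⟨l, rfl⟩ := Nat.exists_eq_add_of_le' hl1
  obtain ⟨L, rfl⟩ : ∃ L : Fin k, (L : ℕ) = l := ⟨⟨l, hlk⟩, rfl⟩
  have hx (i : Fin k) : x ((i : ℕ) + 1) ≠ 0 := hx0 _ (by simp)
  have hupd (i : Fin k) : Function.update x ((L : ℕ) + 1) (q * x ((L : ℕ) + 1)) ((i : ℕ) + 1) =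
      if i = L then q * x ((i : ℕ) + 1) else x ((i : ℕ) + 1) := by
    by_cases hi : i = L
    · simp [hi]
    · have : (i : ℕ) ≠ L := fun h => hi (Fin.ext h)
      simp [hi, this]
  simp only [gammaBar]
  rw [Finset.mul_sum]
  refine Finset.sum_congr rfl fun σ _ => ?_
  simp only [hupd]
  set W : Fin k → ℂ := fun i => z * h ^ (2 * ((k : ℤ) + 1 - 2 * (((σ i : ℕ) : ℤ) + 1))) with hW
  set C : ℂ := q ^ (-(n : ℤ)) * h ^ (-(n : ℤ)) * x ((L : ℕ) + 1) ^ (-(n : ℤ)) *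
    ∏ i ∈ Finset.Icc 1 n, a i with hC
  have hf : ∏ i : Fin k, fEnv q h n a (μ ((σ i : ℕ) + 1))
        (if i = L then q * x ((i : ℕ) + 1) else x ((i : ℕ) + 1)) (W i) =
      (W L * C) * ∏ i : Fin k, fEnv q h n a (μ ((σ i : ℕ) + 1)) (x ((i : ℕ) + 1)) (W i) := by
    rw [show W L * C = ∏ i : Fin k, if i = L then W L * C else 1 by simp,
      ← Finset.prod_mul_distrib]
    refine Finset.prod_congr rfl fun i _ => ?_
    by_cases hi : i = L
    · subst hi
      have hWi : W i ≠ 0 := mul_ne_zero hz (zpow_ne_zero _ hh)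
      rw [if_pos rfl, if_pos rfl, fEnv_mul_left hq hq1 hh ha0
        (hμmem _ (by simp)) (hx i) hWi, hC]
      ring
    · simp [hi]
  have hp : ∏ p ∈ Finset.univ.filter (fun p : Fin k × Fin k => σ p.1 < σ p.2),
        theta q (h ^ 2 * (if p.1 = L then q * x ((p.1 : ℕ) + 1) else x ((p.1 : ℕ) + 1)) /
            (if p.2 = L then q * x ((p.2 : ℕ) + 1) else x ((p.2 : ℕ) + 1))) /
          theta q ((if p.1 = L then q * x ((p.1 : ℕ) + 1) else x ((p.1 : ℕ) + 1)) /
            (if p.2 = L then q * x ((p.2 : ℕ) + 1) else x ((p.2 : ℕ) + 1))) =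
      ((h ^ 2)⁻¹ ^ (k - 1 - (σ L : ℕ)) * (h ^ 2) ^ (σ L : ℕ)) *
        ∏ p ∈ Finset.univ.filter (fun p : Fin k × Fin k => σ p.1 < σ p.2),
          theta q (h ^ 2 * x ((p.1 : ℕ) + 1) / x ((p.2 : ℕ) + 1)) /
            theta q (x ((p.1 : ℕ) + 1) / x ((p.2 : ℕ) + 1)) := by
    rw [← prod_perm_lt_ite_fst σ L, ← prod_perm_lt_ite_snd σ L,
      ← Finset.prod_mul_distrib, ← Finset.prod_mul_distrib]
    refine Finset.prod_congr rfl fun p hp => ?_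
    have hlt := (Finset.mem_filter.mp hp).2
    by_cases h1 : p.1 = L
    · have h2 : p.2 ≠ L := fun h2 => by simp [h1, h2] at hlt
      simp only [if_pos h1, if_neg h2, mul_one]
      exact theta_ratio_mul_left hq hq1 hh (hx _) (hx _)
    · by_cases h2 : p.2 = L
      · simp only [if_neg h1, if_pos h2, one_mul]
        exact theta_ratio_mul_right hq hq1 hh (hx _) (hx _)
      · simp [h1, h2]
  have hcancel : (h ^ 2)⁻¹ ^ (k - 1 - (σ L : ℕ)) * (h ^ 2) ^ (σ L : ℕ) * W L = z := by
    have hσ := (σ L).isLt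
    have : (h ^ 2)⁻¹ ^ (k - 1 - (σ L : ℕ)) * (h ^ 2) ^ (σ L : ℕ) =
        h ^ (-(2 * ((k : ℤ) + 1 - 2 * (((σ L : ℕ) : ℤ) + 1)))) := by
      rw [inv_pow, ← pow_mul, ← pow_mul, ← zpow_natCast, ← zpow_natCast, ← zpow_neg,
        ← zpow_add₀ hh]
      congr 1
      omega
    rw [this, hW, zpow_neg]
    field_simp
  rw [hf, hp]
  linear_combination (C *
    (∏ p ∈ Finset.univ.filter (fun p : Fin k × Fin k => σ p.1 < σ p.2),
      theta q (h ^ 2 * x ((p.1 : ℕ) + 1) / x ((p.2 : ℕ) + 1)) /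
        theta q (x ((p.1 : ℕ) + 1) / x ((p.2 : ℕ) + 1))) *
    ∏ i : Fin k, fEnv q h n a (μ ((σ i : ℕ) + 1)) (x ((i : ℕ) + 1)) (W i)) * hcancel
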